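/- arXiv:2404.05738 — 8 statements merged into one kernel-verified Lean document; each statement's English description precedes it below -/
import Mathlib

section
/- For every x ∈ ℂ and every integer n ≥ 0, the third-order Jacobsthal polynomials satisfy J(n+2) = -J(n+1) - J(n) + x^(n+1). -/
noncomputable section

/-- The third-order Jacobsthal polynomial sequence (evaluated at `x : ℂ`). -/
def J (x : ℂ) : ℕ → ℂ
  | 0 => 0
  | 1 => 1
  | 2 => x - 1
  | n + 3 => (x - 1) * J x (n + 2) + (x - 1) * J x (n + 1) + x * J x n

theorem J_add_two (x : ℂ) (n : ℕ) :
    J x (n + 2) = -J x (n + 1) - J x n + x ^ (n + 1) := by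
  induction n with
  | zero => simp only [J]; ring
  | succ n ih =>
    have h : J x (n + 3) =
        (x - 1) * J x (n + 2) + (x - 1) * J x (n + 1) + x * J x n := by
      rw [J]
    linear_combination h + x * ih
end
end

section
/- Let a, b, c ≥ 1 be integers and x ∈ ℂ. Then for every integer n ≥ 0, BJ(n+2) + BJ(n+1) + BJ(n) = x^(n+1)·(1 + x^a·j1 + x^b·j2 + x^c·j3) in H. -/
noncomputable section

/-- The bihyperbolic numbers over `ℂ`: the group algebra of the Klein four-group
`(ZMod 2 × ZMod 2, +)` over `ℂ`.  Its `ℂ`-basis is `1, j1, j2, j3` with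
`j1² = j2² = j3² = 1`, `j1*j2 = j3`, `j1*j3 = j2`, `j2*j3 = j1`. -/
abbrev H : Type := AddMonoidAlgebra ℂ (ZMod 2 × ZMod 2)

def j1 : H := AddMonoidAlgebra.single (1, 0) 1
def j2 : H := AddMonoidAlgebra.single (0, 1) 1
def j3 : H := AddMonoidAlgebra.single (1, 1) 1

/-- The generalized bihyperbolic third-order Jacobsthal polynomial
`BJ_n^{(a,b,c)}(x) = J_n(x) + J_{n+a}(x) j1 + J_{n+b}(x) j2 + J_{n+c}(x) j3`. -/
def BJ (x : ℂ) (a b c n : ℕ) : H :=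
  algebraMap ℂ H (J x n) + algebraMap ℂ H (J x (n + a)) * j1
    + algebraMap ℂ H (J x (n + b)) * j2 + algebraMap ℂ H (J x (n + c)) * j3

theorem J_sum_three (x : ℂ) (n : ℕ) : J x (n + 2) + J x (n + 1) + J x n = x ^ (n + 1) := by
  induction n with
  | zero => simp [J]
  | succ k ih =>
    rw [show J x (k + 1 + 2) = (x - 1) * J x (k + 2) + (x - 1) * J x (k + 1) + x * J x k from rfl,
      pow_succ, ← ih]
    ring

theorem BJ_sum_three (a b c : ℕ) (ha : 1 ≤ a) (hb : 1 ≤ b) (hc : 1 ≤ c) (x : ℂ) (n : ℕ) :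
    BJ x a b c (n + 2) + BJ x a b c (n + 1) + BJ x a b c n =
      algebraMap ℂ H (x ^ (n + 1)) *
        (1 + algebraMap ℂ H (x ^ a) * j1 + algebraMap ℂ H (x ^ b) * j2
          + algebraMap ℂ H (x ^ c) * j3) := by
  have key (d : ℕ) : algebraMap ℂ H (J x (n + 2 + d)) + algebraMap ℂ H (J x (n + 1 + d))
      + algebraMap ℂ H (J x (n + d)) = algebraMap ℂ H (x ^ (n + 1)) * algebraMap ℂ H (x ^ d) := by
    rw [← map_add, ← map_add, ← map_mul, add_right_comm n 2 d, add_right_comm n 1 d,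
      J_sum_three, ← pow_add, add_right_comm n 1 d]
  have key_zero := key 0
  simp only [add_zero, pow_zero, map_one] at key_zero
  unfold BJ
  linear_combination key_zero + key a * j1 + key b * j2 + key c * j3
end
end

section
/- (Binet formula) Let a, b, c ≥ 1 be integers and let x ∈ ℂ with x³ ≠ 1. Then for every integer n ≥ 0, BJ(n) = x^(n+1)·Θ/(x² + x + 1) - ω1^(n+1)·Φ1/((x - ω1)·(ω1 - ω2)) + ω2^(n+1)·Φ2/((x - ω2)·(ω1 - ω2)) in H. -/
noncomputable section

/-- `Θ(y) = 1 + y^a j1 + y^b j2 + y^c j3`; used for `Θ = Th x a b c`,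
`Φ1 = Th ω1 a b c`, `Φ2 = Th ω2 a b c`. -/
def Th (y : ℂ) (a b c : ℕ) : H :=
  1 + algebraMap ℂ H (y ^ a) * j1 + algebraMap ℂ H (y ^ b) * j2
    + algebraMap ℂ H (y ^ c) * j3

/-- The Binet formula for the third-order Jacobsthal polynomials. -/
theorem J_binet {x ω1 ω2 : ℂ} (hx : x ^ 3 ≠ 1) (hω1 : ω1 ^ 2 + ω1 + 1 = 0)
    (hω2 : ω2 ^ 2 + ω2 + 1 = 0) (hω : ω1 ≠ ω2) (n : ℕ) :
    J x n = x ^ (n + 1) / (x ^ 2 + x + 1) - ω1 ^ (n + 1) / ((x - ω1) * (ω1 - ω2))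
      + ω2 ^ (n + 1) / ((x - ω2) * (ω1 - ω2)) := by
  have hd : ω1 - ω2 ≠ 0 := sub_ne_zero.2 hω
  have hsum : ω2 = -1 - ω1 := mul_left_cancel₀ hd (by linear_combination hω1 - hω2)
  have hfac : x ^ 2 + x + 1 = (x - ω1) * (x - ω2) := by
    rw [hsum]
    linear_combination hω1
  have hD : (x - ω1) * (x - ω2) ≠ 0 := by
    rw [← hfac]
    exact fun h => hx (by linear_combination (x - 1) * h)
  have h1 : x - ω1 ≠ 0 := left_ne_zero_of_mul hD
  have h2 : x - ω2 ≠ 0 := right_ne_zero_of_mul hD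
  rw [hfac]
  induction n using J.induct with
  | case1 =>
    rw [J]
    field_simp
    ring
  | case2 =>
    rw [J]
    field_simp
    ring
  | case3 =>
    rw [J, show x - 1 = x + ω1 + ω2 by rw [hsum]; ring]
    field_simp
    ring
  | case4 n ih2 ih1 ih0 =>
    rw [J, ih2, ih1, ih0]
    simp only [Nat.succ_eq_add_one]
    linear_combination
      ω1 ^ (n + 1) * (ω1 - x) / ((x - ω1) * (ω1 - ω2)) * hω1
        - ω2 ^ (n + 1) * (ω2 - x) / ((x - ω2) * (ω1 - ω2)) * hω2

theorem BJ_binet (a b c : ℕ) (ha : 1 ≤ a) (hb : 1 ≤ b) (hc : 1 ≤ c) (x : ℂ) (hx : x ^ 3 ≠ 1)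
    (ω1 ω2 : ℂ) (hω1 : ω1 ^ 2 + ω1 + 1 = 0) (hω2 : ω2 ^ 2 + ω2 + 1 = 0)
    (hω : ω1 ≠ ω2) (n : ℕ) :
    BJ x a b c n =
      algebraMap ℂ H (x ^ (n + 1) / (x ^ 2 + x + 1)) * Th x a b c
        - algebraMap ℂ H (ω1 ^ (n + 1) / ((x - ω1) * (ω1 - ω2))) * Th ω1 a b c
        + algebraMap ℂ H (ω2 ^ (n + 1) / ((x - ω2) * (ω1 - ω2))) * Th ω2 a b c := by
  simp only [BJ, Th, J_binet hx hω1 hω2 hω, add_right_comm n _ 1, pow_add _ (n + 1),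
    mul_div_right_comm, map_add, map_sub, map_mul]
  ring
end
end

section
/- (Vajda identity for Z) Let a, b, c ≥ 1 be integers and x ∈ ℂ. Then for all integers n, p, q ≥ 0, Z(n+p)·Z(n+q) - Z(n)·Z(n+p+q) = (x² + x + 1)·A(p)·A(q)·Φ1·Φ2 in H. -/
noncomputable section

/-- `Z_n(x) = ((ω1 x - 1) ω1^n Φ1 - (ω2 x - 1) ω2^n Φ2) / (ω1 - ω2)`. -/
def Z (x ω1 ω2 : ℂ) (a b c n : ℕ) : H :=
  algebraMap ℂ H (ω1 - ω2)⁻¹ *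
    (algebraMap ℂ H ((ω1 * x - 1) * ω1 ^ n) * Th ω1 a b c
      - algebraMap ℂ H ((ω2 * x - 1) * ω2 ^ n) * Th ω2 a b c)

/-- `A_k = (ω1^k - ω2^k) / (ω1 - ω2)`. -/
def A (ω1 ω2 : ℂ) (k : ℕ) : ℂ := (ω1 ^ k - ω2 ^ k) / (ω1 - ω2)

/-- The Vajda identity for a Binet-type sequence `d * (u * r ^ n * P - v * s ^ n * Q)` in a
commutative ring. -/
theorem vajda_of_binet {R : Type*} [CommRing R] (d u v r s P Q : R) (n p q : ℕ) :
    d * (u * r ^ (n + p) * P - v * s ^ (n + p) * Q) *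
        (d * (u * r ^ (n + q) * P - v * s ^ (n + q) * Q)) -
      d * (u * r ^ n * P - v * s ^ n * Q) *
        (d * (u * r ^ (n + p + q) * P - v * s ^ (n + p + q) * Q)) =
      u * v * (r * s) ^ n * ((r ^ p - s ^ p) * d) * ((r ^ q - s ^ q) * d) * (P * Q) := by
  ring

theorem Z_vajda (a b c : ℕ) (ha : 1 ≤ a) (hb : 1 ≤ b) (hc : 1 ≤ c) (x : ℂ)
    (ω1 ω2 : ℂ) (hω1 : ω1 ^ 2 + ω1 + 1 = 0) (hω2 : ω2 ^ 2 + ω2 + 1 = 0)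
    (hω : ω1 ≠ ω2) (n p q : ℕ) :
    Z x ω1 ω2 a b c (n + p) * Z x ω1 ω2 a b c (n + q)
      - Z x ω1 ω2 a b c n * Z x ω1 ω2 a b c (n + p + q) =
      algebraMap ℂ H ((x ^ 2 + x + 1) * A ω1 ω2 p * A ω1 ω2 q) *
        (Th ω1 a b c * Th ω2 a b c) := by
  have hadd : ω1 + ω2 = -1 :=
    mul_left_cancel₀ (sub_ne_zero.mpr hω) (by linear_combination hω1 - hω2)
  have hmul : ω1 * ω2 = 1 := by linear_combination ω1 * hadd - hω1
  have hnorm : x ^ 2 + x + 1 = (ω1 * x - 1) * (ω2 * x - 1) * (ω1 * ω2) ^ n := by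
    rw [hmul, one_pow]
    linear_combination x * hadd - x ^ 2 * hmul
  rw [hnorm]
  simp only [Z, A, div_eq_mul_inv, map_mul (algebraMap ℂ H), map_pow (algebraMap ℂ H),
    map_sub (algebraMap ℂ H) (ω1 ^ _)]
  exact vajda_of_binet _ _ _ _ _ _ _ n p q
end
end

section
/- (Catalan identity) Let a, b, c ≥ 1 be integers and let x ∈ ℂ with x ≠ 0 and x³ ≠ 1. Then for all integers n ≥ p ≥ 0, (x² + x + 1)²·(BJ(n+p)·BJ(n-p) - BJ(n)²) = -(x² + x + 1)·A(p)²·Φ1·Φ2 + x^(n+1)·Θ·((Z(n) - x^p·Z(n-p)) - x^(-p)·(Z(n+p) - x^p·Z(n))) in H. -/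
noncomputable section

theorem binet_J (x ω1 ω2 : ℂ) (hω1 : ω1 ^ 2 + ω1 + 1 = 0) (hω2 : ω2 ^ 2 + ω2 + 1 = 0)
    (hω : ω1 ≠ ω2) (n : ℕ) :
    (x ^ 2 + x + 1) * J x n =
      x ^ (n + 1) - (ω1 - ω2)⁻¹ * ((ω1 * x - 1) * ω1 ^ n - (ω2 * x - 1) * ω2 ^ n) := by
  have hd : ω1 - ω2 ≠ 0 := sub_ne_zero.mpr hω
  have hinv : (ω1 - ω2)⁻¹ * (ω1 - ω2) = 1 := inv_mul_cancel₀ hd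
  have hsum : ω1 + ω2 = -1 := by
    apply mul_left_cancel₀ hd
    linear_combination hω1 - hω2
  induction n using J.induct with
  | case1 => simp only [J]; linear_combination x * hinv
  | case2 =>
    simp only [J]
    linear_combination (-1 + x * (ω1 + ω2)) * hinv + x * hsum
  | case3 =>
    simp only [J]
    linear_combination (-(ω1 + ω2)) * hinv - hsum +
      (ω1 - ω2)⁻¹ * x * ((ω1 - 1) * hω1 - (ω2 - 1) * hω2)
  | case4 n h2 h1 h0 =>
    simp only [J, Nat.succ_eq_add_one]
    linear_combination (x - 1) * h2 + (x - 1) * h1 + x * h0 +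
      (ω1 - ω2)⁻¹ * ((ω1 * x - 1) * ω1 ^ n * (ω1 - x) * hω1
        - (ω2 * x - 1) * ω2 ^ n * (ω2 - x) * hω2)

theorem binet_BJ (a b c : ℕ) (x ω1 ω2 : ℂ) (hω1 : ω1 ^ 2 + ω1 + 1 = 0)
    (hω2 : ω2 ^ 2 + ω2 + 1 = 0) (hω : ω1 ≠ ω2) (n : ℕ) :
    algebraMap ℂ H (x ^ 2 + x + 1) * BJ x a b c n =
      algebraMap ℂ H (x ^ (n + 1)) * Th x a b c - Z x ω1 ω2 a b c n := by
  have h (k : ℕ) := congrArg (algebraMap ℂ H) (binet_J x ω1 ω2 hω1 hω2 hω (n + k))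
  have h0 := h 0
  have h1 := h a
  have h2 := h b
  have h3 := h c
  simp only [map_mul, map_sub, map_pow, map_one, map_add, pow_add,
    add_zero, pow_one] at h0 h1 h2 h3
  simp only [BJ, Th, Z, map_mul, map_sub, map_pow, map_one, map_add, pow_add, pow_one]
  linear_combination h0 + h1 * j1 + h2 * j2 + h3 * j3

theorem Z_catalan (a b c : ℕ) (x ω1 ω2 : ℂ) (hprod : ω1 * ω2 = 1) (hsum : ω1 + ω2 = -1)
    (m p : ℕ) :
    Z x ω1 ω2 a b c (m + p + p) * Z x ω1 ω2 a b c m - Z x ω1 ω2 a b c (m + p) ^ 2 =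
      -(algebraMap ℂ H ((x ^ 2 + x + 1) * A ω1 ω2 p ^ 2) *
          (Th ω1 a b c * Th ω2 a b c)) := by
  have hm : ω1 ^ m * ω2 ^ m = 1 := by rw [← mul_pow, hprod, one_pow]
  have hs : (ω1 * x - 1) * (ω2 * x - 1) = x ^ 2 + x + 1 := by
    linear_combination x ^ 2 * hprod - x * hsum
  have key : (x ^ 2 + x + 1) * A ω1 ω2 p ^ 2 =
      (ω1 - ω2)⁻¹ ^ 2 * ((ω1 * x - 1) * (ω2 * x - 1)) * (ω1 ^ m * ω2 ^ m) *
        (ω1 ^ p - ω2 ^ p) ^ 2 := by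
    rw [hm, hs, A]
    ring
  rw [key]
  simp only [Z, map_mul, map_sub, map_pow, map_one, pow_add]
  ring

theorem BJ_catalan (a b c : ℕ) (ha : 1 ≤ a) (hb : 1 ≤ b) (hc : 1 ≤ c) (x : ℂ) (hx0 : x ≠ 0) (hx : x ^ 3 ≠ 1)
    (ω1 ω2 : ℂ) (hω1 : ω1 ^ 2 + ω1 + 1 = 0) (hω2 : ω2 ^ 2 + ω2 + 1 = 0)
    (hω : ω1 ≠ ω2) (n p : ℕ) (hpn : p ≤ n) :
    algebraMap ℂ H ((x ^ 2 + x + 1) ^ 2) *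
        (BJ x a b c (n + p) * BJ x a b c (n - p) - BJ x a b c n ^ 2) =
      -(algebraMap ℂ H ((x ^ 2 + x + 1) * A ω1 ω2 p ^ 2) *
          (Th ω1 a b c * Th ω2 a b c))
      + algebraMap ℂ H (x ^ (n + 1)) * Th x a b c *
          ((Z x ω1 ω2 a b c n - algebraMap ℂ H (x ^ p) * Z x ω1 ω2 a b c (n - p))
            - algebraMap ℂ H ((x⁻¹) ^ p) *
              (Z x ω1 ω2 a b c (n + p) - algebraMap ℂ H (x ^ p) * Z x ω1 ω2 a b c n)) := by
  obtain ⟨m, rfl⟩ := Nat.exists_eq_add_of_le' hpn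
  have hd : ω1 - ω2 ≠ 0 := sub_ne_zero.mpr hω
  have hsum : ω1 + ω2 = -1 := by
    apply mul_left_cancel₀ hd
    linear_combination hω1 - hω2
  have hprod : ω1 * ω2 = 1 := by
    linear_combination ω1 * hsum - hω1
  have hxp : algebraMap ℂ H (x⁻¹) ^ p * algebraMap ℂ H x ^ p = 1 := by
    rw [← mul_pow, ← map_mul, inv_mul_cancel₀ hx0, map_one, one_pow]
  have hB := binet_BJ a b c x ω1 ω2 hω1 hω2 hω
  have h0 := hB m
  have h1 := hB (m + p)
  have h2 := hB (m + p + p)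
  rw [Nat.add_sub_cancel, ← Z_catalan a b c x ω1 ω2 hprod hsum m p, map_pow]
  have expand : algebraMap ℂ H (x ^ 2 + x + 1) ^ 2 *
        (BJ x a b c (m + p + p) * BJ x a b c m - BJ x a b c (m + p) ^ 2) =
      (algebraMap ℂ H (x ^ 2 + x + 1) * BJ x a b c (m + p + p)) *
        (algebraMap ℂ H (x ^ 2 + x + 1) * BJ x a b c m) -
      (algebraMap ℂ H (x ^ 2 + x + 1) * BJ x a b c (m + p)) ^ 2 := by ring
  rw [expand, h0, h1, h2]
  simp only [map_pow, map_mul, pow_add, pow_one]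
  generalize Z x ω1 ω2 a b c (m + p + p) = z2
  generalize Z x ω1 ω2 a b c (m + p) = z1
  generalize Z x ω1 ω2 a b c m = z0
  generalize algebraMap ℂ H (x⁻¹) ^ p = y at *
  linear_combination (algebraMap ℂ H x ^ m * algebraMap ℂ H x * Th x a b c *
    (z2 - algebraMap ℂ H x ^ p * z1)) * hxp
end
end

section
/- For every x ∈ ℂ and every integer n ≥ 0, the third-order Jacobsthal polynomials satisfy 3·(x-1)·(∑_{s=0}^{n} J(s)) = J(n+2) - (x-2)·J(n+1) + x·J(n) - 1. -/
noncomputable section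

theorem J_sum (x : ℂ) (n : ℕ) :
    3 * (x - 1) * (∑ s ∈ Finset.range (n + 1), J x s) =
      J x (n + 2) - (x - 2) * J x (n + 1) + x * J x n - 1 := by
  induction n with
  | zero =>
    simp [J]
    norm_num
  | succ n ih =>
    have hrec : J x (n + 3) = (x - 1) * J x (n + 2) + (x - 1) * J x (n + 1) + x * J x n := by
      rw [J]
    rw [Finset.sum_range_succ, mul_add, ih, show n + 1 + 2 = n + 3 from rfl,
      show n + 1 + 1 = n + 2 from rfl, hrec]
    ring
end
end

section
/- Let a, b, c ≥ 1 be integers and x ∈ ℂ. Then for every integer n ≥ 0, 3·(x-1)·(∑_{s=0}^{n} BJ(s)) = (2x-3)·BJ(0) + (x-2)·BJ(1) - BJ(2) + BJ(n+2) - (x-2)·BJ(n+1) + x·BJ(n) in H. -/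
noncomputable section

theorem BJ_add_three (x : ℂ) (a b c n : ℕ) :
    BJ x a b c (n + 3) = algebraMap ℂ H (x - 1) * BJ x a b c (n + 2)
      + algebraMap ℂ H (x - 1) * BJ x a b c (n + 1) + algebraMap ℂ H x * BJ x a b c n := by
  have hJ (m : ℕ) : J x (m + 3) = (x - 1) * J x (m + 2) + (x - 1) * J x (m + 1) + x * J x m := by
    rw [J]
  simp only [BJ, Nat.add_right_comm n, hJ, map_add, map_mul]
  ring

theorem BJ_sum (a b c : ℕ) (ha : 1 ≤ a) (hb : 1 ≤ b) (hc : 1 ≤ c) (x : ℂ) (n : ℕ) :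
    algebraMap ℂ H (3 * (x - 1)) * (∑ s ∈ Finset.range (n + 1), BJ x a b c s) =
      algebraMap ℂ H (2 * x - 3) * BJ x a b c 0
        + algebraMap ℂ H (x - 2) * BJ x a b c 1
        - BJ x a b c 2
        + BJ x a b c (n + 2)
        - algebraMap ℂ H (x - 2) * BJ x a b c (n + 1)
        + algebraMap ℂ H x * BJ x a b c n := by
  induction n with
  | zero =>
    simp only [zero_add, Finset.sum_range_one, map_sub, map_mul, map_ofNat, map_one]
    ring
  | succ n ih =>
    rw [Finset.sum_range_succ, mul_add, ih, show n + 1 + 2 = n + 3 from rfl, BJ_add_three]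
    simp only [add_assoc, Nat.reduceAdd, map_sub, map_mul, map_ofNat, map_one]
    ring
end
end

section
/- (Matrix generator) Let a, b, c ≥ 1 be integers and x ∈ ℂ. Define T(n) = BJ(n) - (x-1)·BJ(n-1) for n ≥ 1, let Q be the 3×3 matrix over H with rows (x-1, x-1, x), (1, 0, 0), (0, 1, 0), and for n ≥ 0 let M(n) be the 3×3 matrix over H with rows (BJ(n+3), T(n+4), x·BJ(n+2)), (BJ(n+2), T(n+3), x·BJ(n+1)), (BJ(n+1), T(n+2), x·BJ(n)). Then for every integer n ≥ 0, M(n) = M(0)·Qⁿ. -/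
noncomputable section

/-- `T_n = BJ_n - (x-1)·BJ_{n-1}`. -/
def T (x : ℂ) (a b c n : ℕ) : H :=
  BJ x a b c n - algebraMap ℂ H (x - 1) * BJ x a b c (n - 1)

/-- The companion matrix of the recurrence. -/
def Q (x : ℂ) : Matrix (Fin 3) (Fin 3) H :=
  !![algebraMap ℂ H (x - 1), algebraMap ℂ H (x - 1), algebraMap ℂ H x;
     1, 0, 0;
     0, 1, 0]

/-- The matrix `M(n)` built from the generalized bihyperbolic third-order
Jacobsthal polynomials. -/
def M (x : ℂ) (a b c n : ℕ) : Matrix (Fin 3) (Fin 3) H :=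
  !![BJ x a b c (n + 3), T x a b c (n + 4), algebraMap ℂ H x * BJ x a b c (n + 2);
     BJ x a b c (n + 2), T x a b c (n + 3), algebraMap ℂ H x * BJ x a b c (n + 1);
     BJ x a b c (n + 1), T x a b c (n + 2), algebraMap ℂ H x * BJ x a b c n]

theorem J_add_three (x : ℂ) (n : ℕ) :
    J x (n + 3) = (x - 1) * J x (n + 2) + (x - 1) * J x (n + 1) + x * J x n := by
  rw [J]

theorem T_succ (x : ℂ) (a b c n : ℕ) :
    T x a b c (n + 1) = BJ x a b c (n + 1) - algebraMap ℂ H (x - 1) * BJ x a b c n :=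
  rfl

theorem T_add_three (x : ℂ) (a b c n : ℕ) :
    T x a b c (n + 3)
      = algebraMap ℂ H (x - 1) * BJ x a b c (n + 1) + algebraMap ℂ H x * BJ x a b c n := by
  rw [T_succ x a b c (n + 2), BJ_add_three]
  ring

theorem algebraMap_mul_BJ_add_T (x : ℂ) (a b c n : ℕ) :
    algebraMap ℂ H (x - 1) * BJ x a b c n + T x a b c (n + 1) = BJ x a b c (n + 1) := by
  rw [T_succ]
  ring

theorem M_succ (x : ℂ) (a b c n : ℕ) : M x a b c (n + 1) = M x a b c n * Q x := by
  have hB (k : ℕ) : BJ x a b c (k + 1)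
      = BJ x a b c k * algebraMap ℂ H (x - 1) + T x a b c (k + 1) := by
    rw [mul_comm, algebraMap_mul_BJ_add_T]
  have hT (k : ℕ) : T x a b c (k + 3)
      = BJ x a b c (k + 1) * algebraMap ℂ H (x - 1) + algebraMap ℂ H x * BJ x a b c k := by
    rw [mul_comm, T_add_three]
  ext1 i j
  fin_cases i <;> fin_cases j <;>
    simp only [M, Q, Matrix.mul_apply, Fin.sum_univ_three, Matrix.of_apply, Matrix.cons_val,
      Fin.zero_eta, Fin.mk_one, Fin.reduceFinMk, mul_one, mul_zero, add_zero]
  · exact hB (n + 3)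
  · exact hT (n + 2)
  · exact mul_comm _ _
  · exact hB (n + 2)
  · exact hT (n + 1)
  · exact mul_comm _ _
  · exact hB (n + 1)
  · exact hT n
  · exact mul_comm _ _

theorem BJ_matrix_generator (a b c : ℕ) (ha : 1 ≤ a) (hb : 1 ≤ b) (hc : 1 ≤ c) (x : ℂ) (n : ℕ) :
    M x a b c n = M x a b c 0 * Q x ^ n := by
  induction n with
  | zero => simp
  | succ n ih => rw [pow_succ, ← mul_assoc, ← ih, M_succ]
end
end
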